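/- Let ρ be a CJ channel operator from A to k outputs B_1,…,B_k (indexed by (Π i, β i) × a). Suppose the extended marginals ↑ρ_{B_i|A} pairwise commute and ρ = ↑ρ_{B_1|A} · ↑ρ_{B_2|A} ⋯ ↑ρ_{B_k|A}. Then for every i, the quantum conditional mutual information I(B_i : B̄_i | A), evaluated on ρ̂ := (1 / card a) · ρ with the index type grouped as systems (β i, Π_{j≠i} β j, a), equals 0. (Theorem 4, implication from condition 2 to condition 3.) -/

import Mathlib

open Matrix BigOperators
open scoped ComplexOrder

noncomputable section

/-- Partial trace over the first tensor factor. -/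
def ptrace₁ {α β : Type*} [Fintype α] (M : Matrix (α × β) (α × β) ℂ) : Matrix β β ℂ :=
  Matrix.of fun j j' => ∑ i, M (i, j) (i, j')

/-- Partial trace over the second tensor factor. -/
def ptrace₂ {α β : Type*} [Fintype β] (M : Matrix (α × β) (α × β) ℂ) : Matrix α α ℂ :=
  Matrix.of fun i i' => ∑ j, M (i, j) (i', j)

/-- `M` is a Choi–Jamiołkowski channel operator from `a` to `b`: positive semidefinite with
partial trace over the output equal to the identity. -/
def IsCJChannel {b a : Type*} [Fintype b] [Fintype a] [DecidableEq a]
    (M : Matrix (b × a) (b × a) ℂ) : Prop :=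
  M.PosSemidef ∧ ptrace₁ M = 1

/-- The marginal `ρ_{B|A}` of a channel operator `ρ_{BC|A}` (partial trace over `C`). -/
def margB {b c a : Type*} [Fintype c] (ρ : Matrix ((b × c) × a) ((b × c) × a) ℂ) :
    Matrix (b × a) (b × a) ℂ :=
  Matrix.of fun p q => ∑ γ, ρ ((p.1, γ), p.2) ((q.1, γ), q.2)

/-- The marginal `ρ_{C|A}` of a channel operator `ρ_{BC|A}` (partial trace over `B`). -/
def margC {b c a : Type*} [Fintype b] (ρ : Matrix ((b × c) × a) ((b × c) × a) ℂ) :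
    Matrix (c × a) (c × a) ℂ :=
  Matrix.of fun p q => ∑ β, ρ ((β, p.1), p.2) ((β, q.1), q.2)

/-- Extension `↑ρ_{B|A}` of a marginal to the full space, tensoring with the identity on `C`. -/
def extB {b c a : Type*} [DecidableEq c] (M : Matrix (b × a) (b × a) ℂ) :
    Matrix ((b × c) × a) ((b × c) × a) ℂ :=
  Matrix.of fun p q => M (p.1.1, p.2) (q.1.1, q.2) * (if p.1.2 = q.1.2 then 1 else 0)

/-- Extension `↑ρ_{C|A}` of a marginal to the full space, tensoring with the identity on `B`. -/
def extC {b c a : Type*} [DecidableEq b] (M : Matrix (c × a) (c × a) ℂ) :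
    Matrix ((b × c) × a) ((b × c) × a) ℂ :=
  Matrix.of fun p q => M (p.1.2, p.2) (q.1.2, q.2) * (if p.1.1 = q.1.1 then 1 else 0)

/-- The Choi–Jamiołkowski operator of a (unitary) matrix `U`. -/
def cjOf {y x : Type*} (U : Matrix y x ℂ) : Matrix (y × x) (y × x) ℂ :=
  Matrix.of fun p q => U p.1 p.2 * star (U q.1 q.2)

/-- A (possibly rectangular-typed) matrix is unitary if both `U Uᴴ = 1` and `Uᴴ U = 1`. -/
def IsUnitaryMat {y x : Type*} [Fintype y] [Fintype x] [DecidableEq y] [DecidableEq x]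
    (U : Matrix y x ℂ) : Prop :=
  U * Uᴴ = 1 ∧ Uᴴ * U = 1

/-- von Neumann entropy of a matrix (junk value `0` if not Hermitian);
`Real.log 0 = 0` gives the usual convention `0 log 0 = 0`. -/
def vNEntropy {n : Type*} [Fintype n] (M : Matrix n n ℂ) : ℝ :=
  letI := Classical.decEq n
  if h : M.IsHermitian then -∑ i, h.eigenvalues i * Real.log (h.eigenvalues i) else 0

/-- Quantum conditional mutual information `I(B:C|A)` of a matrix on `(b × c) × a`,
with systems grouped as `B`, `C`, `A`. -/
def qcmiBCA {b c a : Type*} [Fintype b] [Fintype c] [Fintype a]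
    (ρ : Matrix ((b × c) × a) ((b × c) × a) ℂ) : ℝ :=
  vNEntropy (margB ρ) + vNEntropy (margC ρ) - vNEntropy ρ - vNEntropy (ptrace₁ ρ)

/-- Conjugation of `ρ` on its `A` indices by a matrix `V` from `a` to `σa`. -/
def conjOnA {o σa a : Type*} [Fintype a] (ρ : Matrix (o × a) (o × a) ℂ)
    (V : Matrix σa a ℂ) : Matrix (o × σa) (o × σa) ℂ :=
  Matrix.of fun p q => ∑ x : a, ∑ x' : a, V p.2 x * ρ (p.1, x) (q.1, x') * star (V q.2 x')

section
variable {k : ℕ} {β : Fin k → Type*} {a : Type*}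
  [∀ i, Fintype (β i)] [∀ i, DecidableEq (β i)] [∀ i, Nonempty (β i)]
  [Fintype a] [DecidableEq a] [Nonempty a]

/-- Insert the value `x` at coordinate `i` of a family defined away from `i`. -/
def insertAt (i : Fin k) (x : β i) (g : ∀ j : {j : Fin k // j ≠ i}, β j.1) : ∀ j, β j :=
  fun j => if h : j = i then cast (congrArg β h).symm x else g ⟨j, h⟩

/-- The marginal `ρ_{B_i|A}`: partial trace over all output factors `j ≠ i`. -/
def margOut (i : Fin k) (ρ : Matrix ((∀ j, β j) × a) ((∀ j, β j) × a) ℂ) :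
    Matrix (β i × a) (β i × a) ℂ :=
  Matrix.of fun p q => ∑ g : ∀ j : {j : Fin k // j ≠ i}, β j.1,
    ρ (insertAt i p.1 g, p.2) (insertAt i q.1 g, q.2)

/-- The marginal `ρ_{B̄_i|A}`: partial trace over output factor `i`. -/
def margRest (i : Fin k) (ρ : Matrix ((∀ j, β j) × a) ((∀ j, β j) × a) ℂ) :
    Matrix ((∀ j : {j : Fin k // j ≠ i}, β j.1) × a)
      ((∀ j : {j : Fin k // j ≠ i}, β j.1) × a) ℂ :=
  Matrix.of fun p q => ∑ x : β i, ρ (insertAt i x p.1, p.2) (insertAt i x q.1, q.2)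

/-- Extension `↑ρ_{B_i|A}` of a marginal to the full output space, tensoring with the
identity on all output factors `j ≠ i`. -/
def extOut (i : Fin k) (M : Matrix (β i × a) (β i × a) ℂ) :
    Matrix ((∀ j, β j) × a) ((∀ j, β j) × a) ℂ :=
  Matrix.of fun p q => M (p.1 i, p.2) (q.1 i, q.2) *
    ∏ j ∈ Finset.univ.erase i, (if p.1 j = q.1 j then (1 : ℂ) else 0)

/-- Quantum conditional mutual information `I(B_i : B̄_i | A)` of a matrix on
`(Π j, β j) × a`, with systems grouped as `B_i`, `Π_{j ≠ i} B_j`, `A`. -/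
def qcmiOut (i : Fin k) (ρ : Matrix ((∀ j, β j) × a) ((∀ j, β j) × a) ℂ) : ℝ :=
  vNEntropy (margOut i ρ) + vNEntropy (margRest i ρ) - vNEntropy ρ - vNEntropy (ptrace₁ ρ)

section Entropy

variable {m n : Type*} [Fintype m] [DecidableEq m] [Fintype n] [DecidableEq n]

open scoped Matrix.Norms.L2Operator in
lemma Matrix.mul_cfc_log_mul_of_commute {X Y : Matrix n n ℂ} (hX : X.IsHermitian)
    (hY : Y.IsHermitian) (hXY : Commute X Y) :
    X * Y * cfc Real.log (X * Y) = X * Y * cfc Real.log X + X * Y * cfc Real.log Y := by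
  set N : Matrix n n ℂ := X + Complex.I • Y with hN
  have hre : (realPart N : Matrix n n ℂ) = X := by
    simp [hN, hX.isSelfAdjoint.coe_realPart, hY.isSelfAdjoint.imaginaryPart]
  have him : (imaginaryPart N : Matrix n n ℂ) = Y := by
    simp [hN, hX.isSelfAdjoint.imaginaryPart, hY.isSelfAdjoint.coe_realPart]
  have hnorm : IsStarNormal N := by
    rw [isStarNormal_iff_commute_realPart_imaginaryPart, hre, him]
    exact hXY
  have hsp : (spectrum ℂ N).Finite := N.finite_spectrum
  have hcont (f : ℂ → ℂ) : ContinuousOn f (spectrum ℂ N) := hsp.continuousOn f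
  have hself : IsSelfAdjoint (X * Y) := (hX.isSelfAdjoint.commute_iff hY.isSelfAdjoint).1 hXY
  have hX1 : cfc (fun z : ℂ => (z.re : ℂ)) N = X := by rw [cfc_re_id N, hre]
  have hY1 : cfc (fun z : ℂ => (z.im : ℂ)) N = Y := by rw [cfc_im_id N, him]
  have hP : X * Y = cfc (fun z : ℂ => (z.re * z.im : ℂ)) N := by
    rw [cfc_mul _ _ N (hcont _) (hcont _), hX1, hY1]
  have hlX : cfc Real.log X = cfc (fun z : ℂ => (Real.log z.re : ℂ)) N := by
    rw [cfc_comp_re Real.log N (Matrix.finite_real_spectrum.continuousOn _), hre]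
  have hlY : cfc Real.log Y = cfc (fun z : ℂ => (Real.log z.im : ℂ)) N := by
    rw [cfc_comp_im Real.log N (Matrix.finite_real_spectrum.continuousOn _), him]
  have hlP : cfc Real.log (X * Y) = cfc (fun z : ℂ => (Real.log (z.re * z.im) : ℂ)) N := by
    rw [cfc_real_eq_complex _ hself, hP, ← cfc_comp' _ _ N ((hsp.image _).continuousOn _) (hcont _)]
    simp
  rw [hlX, hlY, hlP, hP, ← cfc_mul _ _ N (hcont _) (hcont _), ← cfc_mul _ _ N (hcont _) (hcont _),
    ← cfc_mul _ _ N (hcont _) (hcont _), ← cfc_add N _ _ (hcont _) (hcont _)]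
  refine cfc_congr fun z _ => ?_
  by_cases h : z.re = 0 ∨ z.im = 0
  · rcases h with h | h <;> simp [h]
  · push Not at h
    simp only [Real.log_mul h.1 h.2]
    push_cast
    ring

lemma StarAlgHom.map_matrix_cfc (φ : Matrix m m ℂ →⋆ₐ[ℂ] Matrix n n ℂ) (f : ℝ → ℝ)
    {M : Matrix m m ℂ} (hM : M.IsHermitian) : φ (cfc f M) = cfc f (φ M) :=
  φ.map_cfc f M (Matrix.finite_real_spectrum.continuousOn _)
    φ.toAlgHom.toLinearMap.continuous_of_finiteDimensional hM.isSelfAdjoint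
    (hM.isSelfAdjoint.map φ)

lemma vNEntropy_eq_re_trace_cfc {M : Matrix n n ℂ} (hM : M.IsHermitian) :
    vNEntropy M = (cfc Real.negMulLog M).trace.re := by
  have hdec : ‹DecidableEq n› = Classical.decEq n := Subsingleton.elim _ _
  subst hdec
  let := Classical.decEq n
  rw [vNEntropy, dif_pos hM, hM.cfc_eq, Matrix.IsHermitian.cfc, Unitary.conjStarAlgAut_apply,
    Matrix.trace_mul_cycle, Unitary.coe_star_mul_self, one_mul, Matrix.trace_diagonal]
  simp [Real.negMulLog, Finset.sum_neg_distrib]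

lemma vNEntropy_eq_neg_re_trace {M : Matrix n n ℂ} (hM : M.IsHermitian) :
    vNEntropy M = -(M * cfc Real.log M).trace.re := by
  have hc (f : ℝ → ℝ) : ContinuousOn f (spectrum ℝ M) :=
    Matrix.finite_real_spectrum.continuousOn f
  have h : cfc Real.negMulLog M = -(M * cfc Real.log M) := by
    nth_rw 2 [← cfc_id' ℝ M hM.isSelfAdjoint]
    rw [← cfc_mul _ _ M (hc _) (hc _), ← cfc_neg]
    simp only [Real.negMulLog_def, neg_mul]
  rw [vNEntropy_eq_re_trace_cfc hM, h, Matrix.trace_neg, Complex.neg_re]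

lemma vNEntropy_smul {M : Matrix n n ℂ} (hM : M.IsHermitian) (c : ℝ) :
    vNEntropy ((c : ℂ) • M) = c * vNEntropy M + Real.negMulLog c * M.trace.re := by
  have hc (f : ℝ → ℝ) : ContinuousOn f (spectrum ℝ M) :=
    Matrix.finite_real_spectrum.continuousOn f
  have hcM : ((c : ℂ) • M).IsHermitian := by
    simp [Matrix.IsHermitian, Matrix.conjTranspose_smul, hM.eq]
  have hsm : (c : ℂ) • M = cfc (fun x : ℝ => c * x) M := by
    rw [cfc_const_mul _ _ M (hc _), cfc_id' ℝ M hM.isSelfAdjoint]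
    simp
  have h : cfc Real.negMulLog ((c : ℂ) • M) =
      c • cfc Real.negMulLog M + Real.negMulLog c • M := by
    rw [hsm, ← cfc_comp' _ _ M ((Matrix.finite_real_spectrum.image _).continuousOn _) (hc _)
      hM.isSelfAdjoint]
    nth_rw 3 [← cfc_id' ℝ M hM.isSelfAdjoint]
    rw [← cfc_smul _ _ M (hc _), ← cfc_smul _ _ M (hc _), ← cfc_add M _ _ (hc _) (hc _)]
    refine cfc_congr fun x _ => ?_
    simp only [Real.negMulLog_mul, smul_eq_mul]
    ring
  rw [vNEntropy_eq_re_trace_cfc hcM, h, vNEntropy_eq_re_trace_cfc hM]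
  simp

lemma vNEntropy_one : vNEntropy (1 : Matrix n n ℂ) = 0 := by
  rw [vNEntropy_eq_neg_re_trace Matrix.isHermitian_one, cfc_apply_one]
  simp

/-- Reindexing of square matrices along a bijection, as a star algebra homomorphism. -/
def reindexStarAlgHom (e : n ≃ m) : Matrix m m ℂ →⋆ₐ[ℂ] Matrix n n ℂ where
  __ := (Matrix.reindexAlgEquiv ℂ ℂ e.symm).toAlgHom
  map_star' _ := rfl

@[simp]
lemma reindexStarAlgHom_apply (e : n ≃ m) (M : Matrix m m ℂ) :
    reindexStarAlgHom e M = M.submatrix e e := rfl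

lemma vNEntropy_submatrix_equiv {M : Matrix m m ℂ} (hM : M.IsHermitian) (e : n ≃ m) :
    vNEntropy (M.submatrix e e) = vNEntropy M := by
  rw [vNEntropy_eq_re_trace_cfc hM, vNEntropy_eq_re_trace_cfc (hM.submatrix e),
    ← reindexStarAlgHom_apply e M, ← StarAlgHom.map_matrix_cfc _ _ hM, reindexStarAlgHom_apply,
    Matrix.trace, Matrix.trace]
  congr 1
  exact e.sum_comp fun i => cfc Real.negMulLog M i i

end Entropy

section Bipartite

variable {b c d : Type*}

lemma Matrix.IsHermitian.margB [Fintype c] {ρ : Matrix ((b × c) × d) ((b × c) × d) ℂ}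
    (hρ : ρ.IsHermitian) :
    (margB ρ).IsHermitian := by
  ext p q
  simp [_root_.margB, Matrix.conjTranspose_apply, fun i j => (hρ.apply i j)]

lemma Matrix.IsHermitian.margC [Fintype b] {ρ : Matrix ((b × c) × d) ((b × c) × d) ℂ}
    (hρ : ρ.IsHermitian) :
    (margC ρ).IsHermitian := by
  ext p q
  simp only [_root_.margC, Matrix.conjTranspose_apply, Matrix.of_apply, star_sum, hρ.apply]

lemma ptrace₁_margB [Fintype b] [Fintype c] (ρ : Matrix ((b × c) × d) ((b × c) × d) ℂ) :
    ptrace₁ (margB ρ) = ptrace₁ ρ := by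
  ext z z'
  simp [ptrace₁, margB, Fintype.sum_prod_type]

lemma ptrace₁_margC [Fintype b] [Fintype c] (ρ : Matrix ((b × c) × d) ((b × c) × d) ℂ) :
    ptrace₁ (margC ρ) = ptrace₁ ρ := by
  ext z z'
  simp only [ptrace₁, margC, Fintype.sum_prod_type, Matrix.of_apply]
  exact Finset.sum_comm

lemma trace_ptrace₁ [Fintype b] [Fintype d] (M : Matrix (b × d) (b × d) ℂ) :
    (ptrace₁ M).trace = M.trace := by
  simp only [ptrace₁, Matrix.trace, Matrix.diag_apply, Matrix.of_apply, Fintype.sum_prod_type]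
  exact Finset.sum_comm

variable [Fintype b] [Fintype c] [Fintype d]

/-- The extension map `extB`, as a star algebra homomorphism. -/
def extBStarAlgHom (b c d : Type*) [Fintype b] [DecidableEq b] [Fintype c] [DecidableEq c]
    [Fintype d] [DecidableEq d] :
    Matrix (b × d) (b × d) ℂ →⋆ₐ[ℂ] Matrix ((b × c) × d) ((b × c) × d) ℂ where
  toAlgHom := AlgHom.ofLinearMap
    { toFun := extB
      map_add' := fun M N => by ext; simp only [extB, Matrix.of_apply, Matrix.add_apply, add_mul]
      map_smul' := fun r M => by ext; simp [extB] }
    (by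
      ext ⟨⟨x, y⟩, z⟩ ⟨⟨x', y'⟩, z'⟩
      simp [extB, Matrix.one_apply, Prod.ext_iff, ← ite_and, and_assoc, and_left_comm])
    (fun M N => by
      ext ⟨⟨x, y⟩, z⟩ ⟨⟨x', y'⟩, z'⟩
      by_cases h : y = y' <;> simp [extB, Matrix.mul_apply, Fintype.sum_prod_type, h])
  map_star' M := by
    ext ⟨⟨x, y⟩, z⟩ ⟨⟨x', y'⟩, z'⟩
    by_cases h : y = y' <;> simp [extB, Matrix.star_apply, h, Ne.symm]

/-- The extension map `extC`, as a star algebra homomorphism. -/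
def extCStarAlgHom (b c d : Type*) [Fintype b] [DecidableEq b] [Fintype c] [DecidableEq c]
    [Fintype d] [DecidableEq d] :
    Matrix (c × d) (c × d) ℂ →⋆ₐ[ℂ] Matrix ((b × c) × d) ((b × c) × d) ℂ where
  toAlgHom := AlgHom.ofLinearMap
    { toFun := extC
      map_add' := fun M N => by ext; simp only [extC, Matrix.of_apply, Matrix.add_apply, add_mul]
      map_smul' := fun r M => by ext; simp [extC] }
    (by
      ext ⟨⟨x, y⟩, z⟩ ⟨⟨x', y'⟩, z'⟩
      simp [extC, Matrix.one_apply, Prod.ext_iff, ← ite_and, and_assoc])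
    (fun M N => by
      ext ⟨⟨x, y⟩, z⟩ ⟨⟨x', y'⟩, z'⟩
      by_cases h : x = x' <;> simp [extC, Matrix.mul_apply, Fintype.sum_prod_type, h])
  map_star' M := by
    ext ⟨⟨x, y⟩, z⟩ ⟨⟨x', y'⟩, z'⟩
    by_cases h : x = x' <;> simp [extC, Matrix.star_apply, h, Ne.symm]

lemma trace_mul_extB [DecidableEq c] (ρ : Matrix ((b × c) × d) ((b × c) × d) ℂ)
    (L : Matrix (b × d) (b × d) ℂ) : (ρ * extB L).trace = (margB ρ * L).trace := by
  simp only [Matrix.trace, Matrix.diag_apply, Matrix.mul_apply, extB, margB, Matrix.of_apply,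
    Fintype.sum_prod_type, mul_ite, mul_one, mul_zero, Finset.sum_mul]
  simp only [Finset.sum_ite_irrel, Finset.sum_const_zero, Finset.sum_ite_eq', Finset.mem_univ,
    if_true]
  refine Finset.sum_congr rfl fun _ _ => ?_
  rw [Finset.sum_comm]
  refine Finset.sum_congr rfl fun _ _ => ?_
  rw [Finset.sum_comm]
  refine Finset.sum_congr rfl fun _ _ => ?_
  exact Finset.sum_comm

lemma trace_mul_extC [DecidableEq b] (ρ : Matrix ((b × c) × d) ((b × c) × d) ℂ)
    (L : Matrix (c × d) (c × d) ℂ) : (ρ * extC L).trace = (margC ρ * L).trace := by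
  simp only [Matrix.trace, Matrix.diag_apply, Matrix.mul_apply, extC, margC, Matrix.of_apply,
    Fintype.sum_prod_type, mul_ite, mul_one, mul_zero, Finset.sum_mul]
  simp only [Finset.sum_ite_irrel, Finset.sum_const_zero, Finset.sum_ite_eq', Finset.mem_univ,
    if_true]
  rw [Finset.sum_comm]
  refine Finset.sum_congr rfl fun _ _ => ?_
  rw [Finset.sum_comm]
  refine Finset.sum_congr rfl fun _ _ => ?_
  rw [Finset.sum_comm]
  refine Finset.sum_congr rfl fun _ _ => ?_
  exact Finset.sum_comm

lemma margC_extB_mul_extC [DecidableEq d] [DecidableEq b] [DecidableEq c] {P : Matrix (b × d) (b × d) ℂ}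
    (hP : ptrace₁ P = 1) (Q : Matrix (c × d) (c × d) ℂ) :
    margC (extB P * extC Q) = Q := by
  ext ⟨y, z⟩ ⟨y', z'⟩
  have h (w : d) : ∑ x, P (x, z) (x, w) = if z = w then 1 else 0 := by
    simpa [ptrace₁, Matrix.one_apply] using congrFun (congrFun hP z) w
  simp only [margC, extB, extC, Matrix.of_apply, Matrix.mul_apply, Fintype.sum_prod_type]
  simp
  rw [Finset.sum_comm]
  simp [← Finset.sum_mul, h]

/-- An extended product of commuting marginals over a common system has additive entropies. -/
lemma vNEntropy_extB_mul_extC [DecidableEq d] [DecidableEq b] [DecidableEq c]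
    {ρ : Matrix ((b × c) × d) ((b × c) × d) ℂ} (hρ : ρ.IsHermitian)
    (hcomm : Commute (extB (margB ρ)) (extC (margC ρ)))
    (hprod : ρ = extB (margB ρ) * extC (margC ρ)) :
    vNEntropy ρ = vNEntropy (margB ρ) + vNEntropy (margC ρ) := by
  have hB : (extB (c := c) (margB ρ)).IsHermitian :=
    hρ.margB.isSelfAdjoint.map (extBStarAlgHom b c d)
  have hC : (extC (b := b) (margC ρ)).IsHermitian :=
    hρ.margC.isSelfAdjoint.map (extCStarAlgHom b c d)
  have key := Matrix.mul_cfc_log_mul_of_commute hB hC hcomm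
  have hlB : cfc Real.log (extB (c := c) (margB ρ)) = extB (cfc Real.log (margB ρ)) :=
    ((extBStarAlgHom b c d).map_matrix_cfc Real.log hρ.margB).symm
  have hlC : cfc Real.log (extC (b := b) (margC ρ)) = extC (cfc Real.log (margC ρ)) :=
    ((extCStarAlgHom b c d).map_matrix_cfc Real.log hρ.margC).symm
  rw [hlB, hlC, ← hprod] at key
  rw [vNEntropy_eq_neg_re_trace hρ, vNEntropy_eq_neg_re_trace hρ.margB,
    vNEntropy_eq_neg_re_trace hρ.margC, key, Matrix.trace_add, trace_mul_extB, trace_mul_extC,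
    Complex.add_re]
  ring

lemma qcmiBCA_smul_eq_zero_of_extB_mul_extC [DecidableEq b] [DecidableEq c]
    [DecidableEq d] {ρ : Matrix ((b × c) × d) ((b × c) × d) ℂ} (hρ : ρ.IsHermitian)
    (hone : ptrace₁ ρ = 1)
    {Q : Matrix (c × d) (c × d) ℂ} (hcomm : Commute (extB (margB ρ)) (extC Q))
    (hprod : ρ = extB (margB ρ) * extC Q) (r : ℝ) :
    qcmiBCA ((r : ℂ) • ρ) = 0 := by
  have hQ : margC ρ = Q := by
    rw [hprod]
    exact margC_extB_mul_extC ((ptrace₁_margB ρ).trans hone) Q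
  subst hQ
  have hB : margB ((r : ℂ) • ρ) = (r : ℂ) • margB ρ := by
    ext; simp [margB, Finset.mul_sum]
  have hC : margC ((r : ℂ) • ρ) = (r : ℂ) • margC ρ := by
    ext; simp [margC, Finset.mul_sum]
  have hA : ptrace₁ ((r : ℂ) • ρ) = (r : ℂ) • ptrace₁ ρ := by
    ext; simp [ptrace₁, Finset.mul_sum]
  rw [qcmiBCA, hB, hC, hA, hone, vNEntropy_smul hρ, vNEntropy_smul hρ.margB,
    vNEntropy_smul hρ.margC, vNEntropy_smul Matrix.isHermitian_one, vNEntropy_one,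
    vNEntropy_extB_mul_extC hρ hcomm hprod, ← trace_ptrace₁ ρ, ← trace_ptrace₁ (margB ρ),
    ← trace_ptrace₁ (margC ρ), ptrace₁_margB, ptrace₁_margC, hone]
  ring

end Bipartite

/-- Split a family into its `i`-th coordinate and the remaining ones. -/
def insertAtEquiv (β : Fin k → Type*) (i : Fin k) :
    (β i × ∀ j : {j : Fin k // j ≠ i}, β j.1) ≃ ∀ j, β j where
  toFun p := insertAt i p.1 p.2
  invFun v := (v i, fun j => v j.1)
  left_inv p := by
    ext j
    · simp [insertAt]
    · simp [insertAt, j.2]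
  right_inv v := by
    ext j
    by_cases h : j = i
    · subst h; simp [insertAt]
    · simp [insertAt, h]

/-- Split the output systems into the `i`-th one and the remaining ones. -/
def splitOutEquiv (β : Fin k → Type*) (a : Type*) (i : Fin k) :
    (β i × ∀ j : {j : Fin k // j ≠ i}, β j.1) × a ≃ (∀ j, β j) × a :=
  (insertAtEquiv β i).prodCongr (Equiv.refl a)

lemma insertAt_same (i : Fin k) (x : β i) (g : ∀ j : {j : Fin k // j ≠ i}, β j.1) :
    insertAt i x g i = x := by
  simp [insertAt]

lemma insertAt_of_ne {i j : Fin k} (h : j ≠ i) (x : β i)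
    (g : ∀ j : {j : Fin k // j ≠ i}, β j.1) : insertAt i x g j = g ⟨j, h⟩ := by
  simp [insertAt, h]

lemma extOut_submatrix_same (i : Fin k) (M : Matrix (β i × a) (β i × a) ℂ) :
    (extOut i M).submatrix (splitOutEquiv β a i) (splitOutEquiv β a i) = extB M := by
  ext ⟨⟨x, g⟩, z⟩ ⟨⟨x', g'⟩, z'⟩
  have h : (∏ j ∈ Finset.univ.erase i,
      if insertAt i x g j = insertAt i x' g' j then (1 : ℂ) else 0) = if g = g' then 1 else 0 := by
    by_cases hg : g = g'
    · subst hg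
      rw [if_pos rfl]
      refine Finset.prod_eq_one fun j hj => ?_
      simp [insertAt_of_ne (Finset.ne_of_mem_erase hj)]
    · obtain ⟨j, hj⟩ := Function.ne_iff.1 hg
      rw [if_neg hg]
      refine Finset.prod_eq_zero (Finset.mem_erase.2 ⟨j.2, Finset.mem_univ j.1⟩) ?_
      simp [insertAt_of_ne j.2, hj]
  simp [extOut, extB, splitOutEquiv, insertAtEquiv, h, insertAt_same]

lemma exists_extC_eq_extOut_submatrix {i j : Fin k} (hij : j ≠ i)
    (M : Matrix (β j × a) (β j × a) ℂ) :
    ∃ N, extC N = (extOut j M).submatrix (splitOutEquiv β a i) (splitOutEquiv β a i) := by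
  obtain ⟨y⟩ := ‹∀ i, Nonempty (β i)› i
  refine ⟨Matrix.of fun p q => extOut j M (insertAt i y p.1, p.2) (insertAt i y q.1, q.2), ?_⟩
  ext ⟨⟨x, g⟩, z⟩ ⟨⟨x', g'⟩, z'⟩
  have hi : i ∈ Finset.univ.erase j := by simp [hij.symm]
  have h (u u' : β i) : (∏ l ∈ (Finset.univ.erase j).erase i,
      if insertAt i u g l = insertAt i u' g' l then (1 : ℂ) else 0) =
      ∏ l ∈ (Finset.univ.erase j).erase i,
        if insertAt i x g l = insertAt i x' g' l then (1 : ℂ) else 0 := by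
    refine Finset.prod_congr rfl fun l hl => ?_
    have hl' : l ≠ i := Finset.ne_of_mem_erase hl
    simp [insertAt_of_ne hl']
  simp only [extC, extOut, splitOutEquiv, insertAtEquiv, Matrix.of_apply, Matrix.submatrix_apply,
    Equiv.prodCongr_apply, Prod.map, Equiv.coe_fn_mk, Equiv.refl_apply,
    ← Finset.mul_prod_erase _ _ hi, insertAt_same, insertAt_of_ne hij, h y y, if_true]
  ring

lemma ptrace₁_submatrix_splitOutEquiv (i : Fin k)
    (ρ : Matrix ((∀ j, β j) × a) ((∀ j, β j) × a) ℂ) :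
    ptrace₁ (ρ.submatrix (splitOutEquiv β a i) (splitOutEquiv β a i)) = ptrace₁ ρ := by
  ext z z'
  exact (insertAtEquiv β i).sum_comp fun v => ρ (v, z) (v, z')

lemma qcmiOut_eq_qcmiBCA (i : Fin k) {ρ : Matrix ((∀ j, β j) × a) ((∀ j, β j) × a) ℂ}
    (hρ : ρ.IsHermitian) :
    qcmiOut i ρ = qcmiBCA (ρ.submatrix (splitOutEquiv β a i) (splitOutEquiv β a i)) := by
  rw [qcmiOut, qcmiBCA, vNEntropy_submatrix_equiv hρ, ptrace₁_submatrix_splitOutEquiv]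
  rfl

lemma prod_ofFn_eq_mul_prod_eraseIdx {M : Type*} [Monoid M] (f : Fin k → M)
    (hf : ∀ i j, Commute (f i) (f j)) (i : Fin k) :
    (List.ofFn f).prod = f i * ((List.ofFn f).eraseIdx i).prod := by
  have hlen : (i : ℕ) < (List.ofFn f).length := by simp
  rw [← List.mul_prod_eraseIdx hlen]
  · simp
  · intro x hx
    obtain ⟨j, rfl⟩ := List.mem_ofFn.1 (List.mem_of_mem_take hx)
    simpa using hf i j

/-- Theorem 4, 2 ⇒ 3: if a channel operator equals the (pairwise commuting) ordered
product of its extended marginals, then each `I(B_i : B̄_i | A)` vanishes on the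
normalized operator. -/
theorem product_implies_cmi_zero (ρ : Matrix ((∀ j, β j) × a) ((∀ j, β j) × a) ℂ)
    (hρ : ρ.PosSemidef ∧ ptrace₁ ρ = 1)
    (hcomm : ∀ i j : Fin k, Commute (extOut i (margOut i ρ)) (extOut j (margOut j ρ)))
    (hprod : ρ = (List.ofFn fun i => extOut i (margOut i ρ)).prod) :
    ∀ i : Fin k, qcmiOut i ((1 / (Fintype.card a : ℂ)) • ρ) = 0 := by
  intro i
  set f := fun j => extOut j (margOut j ρ)
  set φ := reindexStarAlgHom (splitOutEquiv β a i)
  have hH : (φ ρ).IsHermitian := hρ.1.isHermitian.submatrix _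
  have hone : ptrace₁ (φ ρ) = 1 := (ptrace₁_submatrix_splitOutEquiv i ρ).trans hρ.2
  have hB : φ (f i) = extB (margB (φ ρ)) := extOut_submatrix_same i _
  obtain ⟨Q, hQ⟩ : ∃ Q, extC Q = φ ((List.ofFn f).eraseIdx i).prod := by
    suffices φ ((List.ofFn f).eraseIdx i).prod ∈ (extCStarAlgHom _ _ _).toAlgHom.range from this
    rw [map_list_prod]
    refine Subalgebra.list_prod_mem _ fun y hy => ?_
    obtain ⟨x, hx, rfl⟩ := List.mem_map.1 hy
    obtain ⟨j, hj, hji, rfl⟩ := List.mem_eraseIdx_iff_getElem.1 hx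
    rw [List.getElem_ofFn]
    exact exists_extC_eq_extOut_submatrix (fun h => hji (congrArg Fin.val h)) _
  have hcommQ : Commute (extB (margB (φ ρ))) (extC Q) := by
    rw [← hB, hQ]
    refine Commute.map (Commute.list_prod_right _ _ fun x hx => ?_) φ
    obtain ⟨j, rfl⟩ := List.mem_ofFn.1 (List.mem_of_mem_eraseIdx hx)
    exact hcomm i j
  have hprodQ : φ ρ = extB (margB (φ ρ)) * extC Q := by
    rw [← hB, hQ, ← map_mul, ← prod_ofFn_eq_mul_prod_eraseIdx f hcomm i, ← hprod]
  have hr : (1 / (Fintype.card a : ℂ)) = ((1 / (Fintype.card a : ℝ) : ℝ) : ℂ) := by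
    push_cast; rfl
  rw [hr, qcmiOut_eq_qcmiBCA i, ← reindexStarAlgHom_apply, map_smul]
  · exact qcmiBCA_smul_eq_zero_of_extB_mul_extC hH hone hcommQ hprodQ _
  · simp [Matrix.IsHermitian, Matrix.conjTranspose_smul, hρ.1.isHermitian.eq]

end
end
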